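/- arXiv:2110.09445 — 2 statements merged into one kernel-verified Lean document; each statement's English description precedes it below -/
import Mathlib

section
/- Let B be a C*-algebra and A ⊆ B an abelian closed *-subalgebra satisfying the extension property. Then A is a maximal abelian subalgebra of B: every self-adjoint element b ∈ B commuting with all of A lies in A. -/
open Filter Topology

section StateDefs
variable {E : Type*} [NonUnitalNormedRing E] [StarRing E] [NormedSpace ℂ E]

/-- A state on a (possibly non-unital) C*-algebra: a norm-one linear functional
which is positive, i.e. takes nonnegative real values on elements `star b * b`. -/
def IsState (ψ : E →L[ℂ] ℂ) : Prop :=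
  ‖ψ‖ = 1 ∧ ∀ b : E, ∃ r : ℝ, 0 ≤ r ∧ ψ (star b * b) = (r : ℂ)

/-- A pure state: a state which is an extreme point of the state space. -/
def IsPureState (ψ : E →L[ℂ] ℂ) : Prop :=
  IsState ψ ∧ ∀ ψ₁ ψ₂ : E →L[ℂ] ℂ, ∀ t : ℝ, IsState ψ₁ → IsState ψ₂ →
    0 < t → t < 1 → ψ = t • ψ₁ + (1 - t) • ψ₂ → ψ₁ = ψ

end StateDefs


theorem aux_pos {U : Type*} [CStarAlgebra U] (ψ : U →L[ℂ] ℂ) (h1 : ψ 1 = 1)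
    (hn : ‖ψ‖ ≤ 1) (b : U) : ∃ r : ℝ, 0 ≤ r ∧ ψ (star b * b) = (r : ℂ) := by
  letI := CStarAlgebra.spectralOrder U
  letI := CStarAlgebra.spectralOrderedRing U
  have hle : ∀ x, ‖ψ x‖ ≤ ‖x‖ := fun x => by
    simpa using ψ.le_of_opNorm_le hn x
  have h0 : 0 ≤ star b * b := star_mul_self_nonneg b
  set h := star b * b with hh
  have hsa : star h = h := (IsSelfAdjoint.of_nonneg h0)
  have hnt : Nontrivial U := ⟨1, 0, fun h => by simp [h] at h1⟩
  have him : ∀ t : ℝ, ‖ψ h + (t : ℂ) * Complex.I‖ ^ 2 ≤ ‖h‖ ^ 2 + t ^ 2 := by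
    intro t
    set z : U := h + ((t : ℂ) * Complex.I) • (1 : U) with hz
    have e1 : ψ z = ψ h + (t : ℂ) * Complex.I := by simp [hz, h1]
    have e2 : star z * z = h * h + ((t : ℂ) ^ 2) • (1 : U) := by
      simp only [hz, star_add, star_smul, hsa, star_one, add_mul, mul_add, smul_mul_assoc,
        mul_smul_comm, one_mul, mul_one]
      have : star ((t : ℂ) * Complex.I) = - ((t : ℂ) * Complex.I) := by simp
      rw [this]
      have : (t : ℂ) * Complex.I * -((t : ℂ) * Complex.I) = (t : ℂ) ^ 2 := by
        linear_combination (-(t : ℂ) ^ 2) * Complex.I_sq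
      rw [smul_add, smul_smul, this, neg_smul]
      abel
    rw [← e1]
    calc ‖ψ z‖ ^ 2 ≤ ‖z‖ ^ 2 := by gcongr; exact hle z
      _ = ‖star z * z‖ := by rw [CStarRing.norm_star_mul_self, sq]
      _ ≤ ‖h * h‖ + ‖((t : ℂ) ^ 2) • (1 : U)‖ := by rw [e2]; exact norm_add_le _ _
      _ ≤ ‖h‖ ^ 2 + t ^ 2 := by
        gcongr
        · rw [sq]; exact norm_mul_le _ _
        · rw [norm_smul]; simp
  have him0 : (ψ h).im = 0 := by
    have key : ∀ t : ℝ, (ψ h).re ^ 2 + (ψ h).im ^ 2 + 2 * t * (ψ h).im ≤ ‖h‖ ^ 2 := by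
      intro t
      have := him t
      rw [Complex.sq_norm, Complex.normSq_apply] at this
      simp at this
      nlinarith
    by_contra hne
    have := key ((‖h‖ ^ 2 + 1) / (2 * (ψ h).im))
    have e : 2 * ((‖h‖ ^ 2 + 1) / (2 * (ψ h).im)) * (ψ h).im = ‖h‖ ^ 2 + 1 := by
      field_simp
    nlinarith [sq_nonneg (ψ h).re, sq_nonneg (ψ h).im]
  refine ⟨(ψ h).re, ?_, Complex.ext rfl (by simpa using him0)⟩
  have e3 : ‖algebraMap ℝ U ‖h‖ - h‖ ≤ ‖h‖ := by
    rw [CStarAlgebra.norm_le_iff_le_algebraMap _ (norm_nonneg _)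
      (sub_nonneg.2 (IsSelfAdjoint.le_algebraMap_norm_self hsa))]
    exact sub_le_self _ h0
  have e4 : ψ (algebraMap ℝ U ‖h‖ - h) = (‖h‖ : ℂ) - ψ h := by
    rw [Algebra.algebraMap_eq_smul_one, map_sub, ← Complex.coe_smul, map_smul, h1]; simp
  have e5 := (Complex.abs_re_le_norm _).trans ((hle _).trans e3)
  rw [e4] at e5
  simp at e5
  have := (abs_le.1 e5).2
  linarith

theorem aux_cs {E : Type*} [NonUnitalCStarAlgebra E] (ψ : E →L[ℂ] ℂ)
    (hp : ∀ b : E, ∃ r : ℝ, 0 ≤ r ∧ ψ (star b * b) = (r : ℂ)) (a : E)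
    (ha : ψ (star a * a) = 0) (x : E) : ψ (star x * a) = 0 := by
  set p := ψ (star x * a) with hp'
  set q := ψ (star a * x) with hq'
  obtain ⟨P, hP, hPe⟩ := hp x
  have key : ∀ c : ℂ, 0 ≤ (c * p + star c * q).re + P ∧ (c * p + star c * q).im = 0 := by
    intro c
    obtain ⟨r, hr, hre⟩ := hp (x + c • a)
    have : ψ (star (x + c • a) * (x + c • a)) = P + (c * p + star c * q) := by
      simp only [star_add, star_smul, add_mul, mul_add, smul_mul_assoc, mul_smul_comm,
        map_add, map_smul, ha, hPe, smul_eq_mul]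
      simp only [hp', hq']; ring
    rw [this] at hre
    have h1 := congrArg Complex.re hre
    have h2 := congrArg Complex.im hre
    simp only [Complex.add_re, Complex.add_im, Complex.ofReal_re, Complex.ofReal_im] at h1 h2
    simp only [Complex.add_re, Complex.add_im]
    constructor <;> linarith
  have k1 := (key 1).2
  have k2 := (key Complex.I).2
  simp at k1 k2
  have k3 := (key (-((P + 1 : ℝ) / (2 * Complex.normSq p) : ℝ) * star p)).1
  by_contra hne
  have hpos : 0 < Complex.normSq p := Complex.normSq_pos.2 hne
  have hq : q = star p := by
    apply Complex.ext <;> simp <;> linarith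
  rw [hq] at k3
  have e : (-((P + 1 : ℝ) / (2 * Complex.normSq p) : ℝ) * star p) * p +
    star (-((P + 1 : ℝ) / (2 * Complex.normSq p) : ℝ) * star p) * star p =
      ((-(P + 1) : ℝ) : ℂ) := by
    have e1 : star p * p = (Complex.normSq p : ℂ) := Complex.normSq_eq_conj_mul_self.symm
    have e2 : ((-((P + 1 : ℝ) / (2 * Complex.normSq p) : ℝ) : ℂ)) * (2 * Complex.normSq p)
        = ((-(P + 1) : ℝ) : ℂ) := by
      rw [← Complex.ofReal_neg]
      norm_cast
      field_simp
    rw [← e2, ← e1]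
    simp
    ring
  rw [e] at k3
  simp at k3
  linarith

theorem aux_norm {E : Type*} [NonUnitalCStarAlgebra E] (χ : E →⋆ₙₐ[ℂ] ℂ) (φ : E →L[ℂ] ℂ)
    (hφ : ∀ a, φ a = χ a) (h0 : ∃ a, χ a ≠ 0) : ∃ e : E, ‖e‖ ≤ 1 ∧ χ e = 1 := by
  obtain ⟨c, hc⟩ := h0
  set s : ℝ := Complex.normSq (χ c) with hs
  have hs0 : 0 < s := Complex.normSq_pos.2 hc
  have hsa : IsSelfAdjoint (star c * c) := IsSelfAdjoint.star_mul_self c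
  have hχ : χ (star c * c) = algebraMap ℝ ℂ s := by
    rw [map_mul, map_star]; exact Complex.normSq_eq_conj_mul_self.symm
  let f : ℝ → ℝ := fun t => min 1 (|t| / s)
  have hf : Continuous f := by fun_prop
  have hf0 : f 0 = 0 := by simp [f]
  have hχc : Continuous χ := by
    have : (χ : E → ℂ) = φ := by ext a; exact (hφ a).symm
    rw [this]; exact φ.continuous
  refine ⟨cfcₙ f (star c * c), norm_cfcₙ_le fun x _ => ?_, ?_⟩
  · have : 0 ≤ f x := by positivity
    rw [Real.norm_of_nonneg this]; exact min_le_left _ _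
  · rw [NonUnitalStarAlgHomClass.map_cfcₙ χ f (star c * c) hf.continuousOn hf0 hχc hsa
      (hsa.map χ), cfcₙ_eq_cfc hf.continuousOn hf0, hχ, cfc_algebraMap]
    have : f s = 1 := by simp [f, abs_of_pos hs0, hs0.ne']
    simp [this]

theorem aux_pure {E : Type*} [NonUnitalCStarAlgebra E] (χ : E →⋆ₙₐ[ℂ] ℂ) (φ : E →L[ℂ] ℂ)
    (hφ : ∀ a, φ a = χ a) (h0 : ∃ a, χ a ≠ 0) (hn : ‖φ‖ ≤ 1)
    {ι : Type*} (l : Filter ι) [l.NeBot] (u : ι → E)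
    (hu : ∀ a : E, Tendsto (fun i => u i * a) l (𝓝 a)) : IsPureState φ := by
  obtain ⟨e, he, hχe⟩ := aux_norm χ φ hφ h0
  have hst : IsState φ := by
    refine ⟨le_antisymm hn ?_, fun b => ⟨Complex.normSq (χ b), Complex.normSq_nonneg _, ?_⟩⟩
    · have := φ.le_opNorm e
      rw [hφ, hχe, norm_one] at this
      nlinarith [norm_nonneg φ]
    · rw [hφ, map_mul, map_star]; exact Complex.normSq_eq_conj_mul_self.symm
  refine ⟨hst, fun ψ₁ ψ₂ t h1 h2 ht0 ht1 heq => ?_⟩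
  have hker : ∀ a, φ a = 0 → ψ₁ a = 0 := by
    intro a ha
    have hz : ψ₁ (star a * a) = 0 := by
      obtain ⟨r1, hr1, e1⟩ := h1.2 a
      obtain ⟨r2, hr2, e2⟩ := h2.2 a
      have h3 : φ (star a * a) = 0 := by rw [hφ, map_mul, ← hφ a, ha, mul_zero]
      rw [heq] at h3
      simp only [add_apply, smul_apply, e1, e2,
        Complex.real_smul] at h3
      have h4 : t * r1 + (1 - t) * r2 = 0 := by exact_mod_cast h3
      have h5 : r1 = 0 := by
        have : 0 ≤ (1 - t) * r2 := mul_nonneg (by linarith) hr2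
        nlinarith
      rw [e1, h5]; simp
    have hx : ∀ x, ψ₁ (x * a) = 0 := fun x => by
      simpa using aux_cs ψ₁ h1.2 a hz (star x)
    have := (ψ₁.continuous.tendsto a).comp (hu a)
    refine tendsto_nhds_unique this ?_
    simp only [Function.comp_def, hx]
    exact tendsto_const_nhds
  have hmul : ∀ a, ψ₁ a = ψ₁ e * φ a := by
    intro a
    have : φ (a - φ a • e) = 0 := by simp [hφ, hχe]
    have := hker _ this
    simp [sub_eq_zero] at this
    rw [this, mul_comm]
  have hc : ψ₁ e = 1 := by
    obtain ⟨r, hr, hre⟩ := h1.2 e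
    have e1 : ψ₁ e = r := by
      rw [← hre, hmul (star e * e), hφ, map_mul, map_star, hχe]; simp
    have e2 : ψ₁ = ψ₁ e • φ := by ext a; simpa using hmul a
    have e3 : ‖ψ₁‖ = ‖ψ₁ e‖ * ‖φ‖ := by
      conv_lhs => rw [e2]
      exact norm_smul _ _
    rw [h1.1, hst.1, e1, mul_one, Complex.norm_real, Real.norm_of_nonneg hr] at e3
    rw [e1, ← e3]; simp
  ext a
  rw [hmul, hc, one_mul]

theorem aux_ext {B : Type*} [NonUnitalCStarAlgebra B] (C : StarSubalgebra ℂ (Unitization ℂ B))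
    (f : C →L[ℂ] ℂ) (hf : ‖f‖ ≤ 1) (h1 : f 1 = 1) :
    ∃ ψ : B →L[ℂ] ℂ, ‖ψ‖ ≤ 1 ∧ (∀ b : B, ∃ r : ℝ, 0 ≤ r ∧ ψ (star b * b) = (r : ℂ)) ∧
      ∀ (b : B) (hb : (b : Unitization ℂ B) ∈ C), ψ b = f ⟨b, hb⟩ := by
  obtain ⟨g, hg, hgn⟩ := exists_extension_norm_eq (Subalgebra.toSubmodule C.toSubalgebra) f
  have hgn' : ‖g‖ ≤ 1 := hgn.trans_le hf
  have hg1 : g 1 = 1 := (hg ⟨1, one_mem C⟩).trans h1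
  let ψ₀ : B →ₗ[ℂ] ℂ := g.toLinearMap ∘ₗ (Unitization.inrHom ℂ ℂ B)
  have hb0 : ∀ b, ‖ψ₀ b‖ ≤ 1 * ‖b‖ := fun b => by
    have := g.le_of_opNorm_le hgn' (b : Unitization ℂ B)
    rwa [Unitization.norm_inr] at this
  refine ⟨ψ₀.mkContinuous 1 hb0, LinearMap.mkContinuous_norm_le _ zero_le_one _, fun b => ?_,
    fun b hb => hg ⟨b, hb⟩⟩
  obtain ⟨r, hr, e⟩ := aux_pos g hg1 hgn' (b : Unitization ℂ B)
  refine ⟨r, hr, ?_⟩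
  rw [← e, ← Unitization.inr_star, ← Unitization.inr_mul]
  rfl

def auxUnit {B : Type*} [NonUnitalCStarAlgebra B] (A : NonUnitalStarSubalgebra ℂ B) :
    StarSubalgebra ℂ (Unitization ℂ B) where
  carrier := {x | x.snd ∈ A}
  mul_mem' {x y} hx hy := by
    simp only [Set.mem_ofPred_eq, Unitization.snd_mul] at *
    exact add_mem (add_mem (SMulMemClass.smul_mem _ hy) (SMulMemClass.smul_mem _ hx)) (mul_mem hx hy)
  add_mem' {x y} hx hy := by
    simp only [Set.mem_ofPred_eq, Unitization.snd_add] at *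
    exact add_mem hx hy
  algebraMap_mem' r := by
    simp [Unitization.algebraMap_eq_inl]
  star_mem' {x} hx := by
    simp only [Set.mem_ofPred_eq, Unitization.snd_star] at *
    exact star_mem hx

theorem aux_main {B : Type*} [NonUnitalCStarAlgebra B]
    (A : NonUnitalStarSubalgebra ℂ B) (hA : IsClosed (A : Set B))
    (habel : ∀ a ∈ A, ∀ a' ∈ A, a * a' = a' * a)
    (hext : ∀ φ : ↥A →L[ℂ] ℂ, IsPureState φ →
      ∃! ψ : B →L[ℂ] ℂ, IsState ψ ∧ ∀ a : ↥A, ψ ↑a = φ a)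
    {ι : Type*} (l : Filter ι) [l.NeBot] (u : ι → B) (hu : ∀ i, u i ∈ A)
    (happrox : ∀ b : B, Tendsto (fun i => u i * b) l (𝓝 b) ∧
      Tendsto (fun i => b * u i) l (𝓝 b))
    (b : B) (hb : IsSelfAdjoint b) (hcomm : ∀ a ∈ A, b * a = a * b) :
    b ∈ A := by
  let S : Set (Unitization ℂ B) := {x | ∃ a : B, (a ∈ A ∨ a = b) ∧ x = a}
  have hS : ∀ x ∈ S, ∀ y ∈ S, x * y = y * x := by
    rintro _ ⟨x, hx, rfl⟩ _ ⟨y, hy, rfl⟩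
    rw [← Unitization.inr_mul, ← Unitization.inr_mul]
    congr 1
    rcases hx with hx | rfl <;> rcases hy with hy | rfl
    · exact habel _ hx _ hy
    · exact (hcomm _ hx).symm
    · exact hcomm _ hy
    · rfl
  have hSs : ∀ x ∈ S, star x ∈ S := by
    rintro _ ⟨x, hx, rfl⟩
    refine ⟨star x, ?_, by simp⟩
    rcases hx with hx | rfl
    · exact Or.inl (star_mem hx)
    · exact Or.inr hb
  let C := (StarAlgebra.adjoin ℂ S).topologicalClosure
  have hSC : ∀ x ∈ S, x ∈ C := fun x hx =>
    StarSubalgebra.le_topologicalClosure _ (StarAlgebra.subset_adjoin ℂ S hx)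
  have hCc : ∀ x y : C, x * y = y * x := by
    have h1 := (StarAlgebra.adjoinCommRingOfComm ℂ hS
      (fun x hx y hy => hS x hx _ (hSs y hy))).mul_comm
    exact ((StarAlgebra.adjoin ℂ S).commRingTopologicalClosure h1).mul_comm
  haveI hCcl : IsClosed (C : Set (Unitization ℂ B)) :=
    StarSubalgebra.isClosed_topologicalClosure _
  letI iC : CommCStarAlgebra C := { StarSubalgebra.cstarAlgebra C with mul_comm := hCc }
  have hAC : ∀ a : A, ((a : B) : Unitization ℂ B) ∈ C := fun a => hSC _ ⟨a, Or.inl a.2, rfl⟩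
  have hbC : (b : Unitization ℂ B) ∈ C := hSC _ ⟨b, Or.inr rfl, rfl⟩
  haveI : IsClosed (A : Set B) := hA
  letI iA : NonUnitalCStarAlgebra A := NonUnitalStarSubalgebra.nonUnitalCStarAlgebra A
  -- separation
  have hsep : ∀ χ₁ χ₂ : WeakDual.characterSpace ℂ C,
      (∀ a : A, χ₁ ⟨_, hAC a⟩ = χ₂ ⟨_, hAC a⟩) → χ₁ = χ₂ := by
    intro χ₁ χ₂ h
    suffices hbb : χ₁ ⟨_, hbC⟩ = χ₂ ⟨_, hbC⟩ by
      refine StarAlgHomClass.ext_topologicalClosure (R := ℂ) (map_continuous χ₁)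
        (map_continuous χ₂) fun x => ?_
      refine StarAlgebra.adjoin_induction_subtype x ?_ ?_ ?_ ?_ ?_
      · rintro y ⟨a, ha | rfl, rfl⟩
        · exact h ⟨a, ha⟩
        · exact hbb
      · intro r; simp only [AlgHomClass.commutes]
      · intro x y hx hy; simp only [map_add, hx, hy]
      · intro x y hx hy; simp only [map_mul, hx, hy]
      · intro x hx; simp only [map_star, hx]
    by_cases h0 : ∀ a : A, χ₁ ⟨_, hAC a⟩ = 0
    · have hz : ∀ χ : WeakDual.characterSpace ℂ C, (∀ a : A, χ ⟨_, hAC a⟩ = 0) →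
          χ ⟨_, hbC⟩ = 0 := by
        intro χ hχ
        have ht : Tendsto (fun i => (⟨_, hAC ⟨u i, hu i⟩⟩ : C) * ⟨_, hbC⟩) l (𝓝 ⟨_, hbC⟩) := by
          rw [tendsto_subtype_rng]
          have := (Unitization.continuous_inr (𝕜 := ℂ)).tendsto b |>.comp (happrox b).1
          simpa [Function.comp_def] using this
        have ht2 := ((map_continuous χ).tendsto _).comp ht
        refine tendsto_nhds_unique ht2 ?_
        have hz0 : ∀ i, χ ((⟨_, hAC ⟨u i, hu i⟩⟩ : C) * ⟨_, hbC⟩) = 0 := fun i =>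
          (map_mul χ (⟨_, hAC ⟨u i, hu i⟩⟩ : C) ⟨_, hbC⟩).trans
            (by erw [hχ ⟨u i, hu i⟩]; exact zero_mul _)
        exact tendsto_const_nhds.congr fun i => (hz0 i).symm
      rw [hz χ₁ h0, hz χ₂ fun a => (h a).symm.trans (h0 a)]
    · push Not at h0
      have hst : ∀ χ : WeakDual.characterSpace ℂ C, ∃ ψ : B →L[ℂ] ℂ, ‖ψ‖ ≤ 1 ∧
          (∀ b : B, ∃ r : ℝ, 0 ≤ r ∧ ψ (star b * b) = (r : ℂ)) ∧
          ∀ (b : B) (hb : (b : Unitization ℂ B) ∈ C), ψ b = χ ⟨b, hb⟩ := by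
        intro χ
        exact aux_ext C (WeakDual.toStrongDual (χ : WeakDual ℂ C))
          ((WeakDual.CharacterSpace.norm_le_norm_one χ).trans (by simp)) (map_one χ)
      obtain ⟨ψ₁, hn1, hp1, e1⟩ := hst χ₁
      obtain ⟨ψ₂, hn2, hp2, e2⟩ := hst χ₂
      let χ : A →⋆ₙₐ[ℂ] ℂ :=
        { toFun := fun a => χ₁ ⟨_, hAC a⟩
          map_smul' := fun c a => by
            rw [← map_smul]; congr 1; ext1; simp
          map_zero' := by
            rw [← map_zero χ₁]; congr 1
          map_add' := fun x y => by
            rw [← map_add]; congr 1; ext1; simp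
          map_mul' := fun x y => by
            rw [← map_mul]; congr 1; ext1; simp
          map_star' := fun x => by
            rw [← map_star]; congr 1; ext1; simp }
      let φ₀ : A →ₗ[ℂ] ℂ := ⟨⟨χ, map_add χ⟩, map_smul χ⟩
      have hφb : ∀ a, ‖φ₀ a‖ ≤ 1 * ‖a‖ := fun a => by
        have := ψ₁.le_of_opNorm_le hn1 (a : B)
        rw [e1 _ (hAC a)] at this
        exact this
      let φ : A →L[ℂ] ℂ := φ₀.mkContinuous 1 hφb
      have hφ : ∀ a, φ a = χ a := fun a => rfl
      have hpure : IsPureState φ := by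
        refine aux_pure χ φ hφ h0 (LinearMap.mkContinuous_norm_le _ zero_le_one _) l
          (fun i => ⟨u i, hu i⟩) fun a => ?_
        rw [tendsto_subtype_rng]
        exact (happrox a).1
      obtain ⟨e, he, hχe⟩ := aux_norm χ φ hφ h0
      have hS : ∀ ψ : B →L[ℂ] ℂ, ‖ψ‖ ≤ 1 → (∀ a : A, ψ a = φ a) → ‖ψ‖ = 1 := by
        intro ψ hψ hψa
        refine le_antisymm hψ ?_
        have h3 := ψ.le_opNorm e
        rw [hψa, hφ, hχe, norm_one] at h3
        have : ‖(e : B)‖ ≤ 1 := he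
        nlinarith [norm_nonneg ψ]
      have a1 : ∀ a : A, ψ₁ a = φ a := fun a => e1 _ (hAC a)
      have a2 : ∀ a : A, ψ₂ a = φ a := fun a => (e2 _ (hAC a)).trans (h a).symm
      have := (hext φ hpure).unique ⟨⟨hS ψ₁ hn1 a1, hp1⟩, a1⟩ ⟨⟨hS ψ₂ hn2 a2, hp2⟩, a2⟩
      rw [← e1, ← e2, this]
  -- Stone-Weierstrass
  let D : StarSubalgebra ℂ C := (auxUnit A).comap C.subtype
  let G := gelfandStarTransform C
  let D' : StarSubalgebra ℂ C(WeakDual.characterSpace ℂ C, ℂ) :=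
    D.map (G : C →⋆ₐ[ℂ] C(WeakDual.characterSpace ℂ C, ℂ))
  have hD' : D'.topologicalClosure = ⊤ := by
    apply ContinuousMap.starSubalgebra_topologicalClosure_eq_top_of_separatesPoints
    intro χ₁ χ₂ hne
    by_contra hcon
    refine hne (hsep χ₁ χ₂ fun a => ?_)
    by_contra hne2
    refine hcon ⟨G ⟨_, hAC a⟩, ⟨G ⟨_, hAC a⟩, ⟨⟨_, hAC a⟩, ?_, rfl⟩, rfl⟩, hne2⟩
    exact a.2
  have hmem : G ⟨_, hbC⟩ ∈ closure ((G : C → C(WeakDual.characterSpace ℂ C, ℂ)) '' (D : Set C)) := by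
    have : G ⟨_, hbC⟩ ∈ D'.topologicalClosure := by rw [hD']; trivial
    exact this
  have hiso : Isometry (G : C → C(WeakDual.characterSpace ℂ C, ℂ)) := gelfandTransform_isometry C
  have hmem2 : (⟨_, hbC⟩ : C) ∈ closure (D : Set C) := by
    rw [hiso.isUniformInducing.isInducing.closure_eq_preimage_closure_image]
    exact hmem
  have hDcl : IsClosed (D : Set C) :=
    hA.preimage ((Unitization.continuous_snd).comp continuous_subtype_val)
  rw [hDcl.closure_eq] at hmem2
  exact hmem2

variable {B : Type*} [NonUnitalNormedRing B] [StarRing B] [CStarRing B]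
  [NormedSpace ℂ B] [IsScalarTower ℂ B B] [SMulCommClass ℂ B B] [StarModule ℂ B]
  [CompleteSpace B]

/-- If `A` is an abelian closed *-subalgebra of `B` satisfying the extension
property (pure states of `A` extend uniquely to states of `B`, and `A` contains an
approximate identity for `B`), then `A` is maximal abelian: every self-adjoint
element commuting with `A` lies in `A`. -/
theorem maximal_abelian_of_extensionProperty
    (A : NonUnitalStarSubalgebra ℂ B) (hA : IsClosed (A : Set B))
    (habel : ∀ a ∈ A, ∀ a' ∈ A, a * a' = a' * a)
    (hext : ∀ φ : ↥A →L[ℂ] ℂ, IsPureState φ →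
      ∃! ψ : B →L[ℂ] ℂ, IsState ψ ∧ ∀ a : ↥A, ψ ↑a = φ a)
    {ι : Type*} (l : Filter ι) [l.NeBot] (u : ι → B) (hu : ∀ i, u i ∈ A)
    (happrox : ∀ b : B, Tendsto (fun i => u i * b) l (𝓝 b) ∧
      Tendsto (fun i => b * u i) l (𝓝 b))
    (b : B) (hb : IsSelfAdjoint b) (hcomm : ∀ a ∈ A, b * a = a * b) :
    b ∈ A := by
  letI : NonUnitalCStarAlgebra B := {}
  exact aux_main A hA habel hext l u hu happrox b hb hcomm
end

section
/- Let B₁ be a quotient of a C*-algebra B by a closed two-sided ideal I, with quotient map π, and let A ⊆ B be a closed *-subalgebra with A ∩ I = {0}, so that π restricts to an isometric embedding of A into B₁. If A satisfies the extension property relative to B, then π(A) satisfies the extension property relative to B₁. -/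
open Filter Topology

variable {B : Type*} [NonUnitalNormedRing B] [StarRing B] [CStarRing B]
  [NormedSpace ℂ B] [IsScalarTower ℂ B B] [SMulCommClass ℂ B B] [StarModule ℂ B]
  [CompleteSpace B]

/-- `A` (as a set) contains an approximate unit for `B`. -/
def HasApproxUnitIn (A : NonUnitalStarSubalgebra ℂ B) : Prop :=
  ∃ (ι : Type) (l : Filter ι) (u : ι → B), l.NeBot ∧ (∀ i, u i ∈ A) ∧
    ∀ b : B, Tendsto (fun i => u i * b) l (𝓝 b) ∧
      Tendsto (fun i => b * u i) l (𝓝 b)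

/-- The extension property: every pure state of `A` extends uniquely to a state of
`B`, and `A` contains an approximate identity for `B`. -/
def ExtensionProperty (A : NonUnitalStarSubalgebra ℂ B) : Prop :=
  (∀ φ : ↥A →L[ℂ] ℂ, IsPureState φ →
    ∃! ψ : B →L[ℂ] ℂ, IsState ψ ∧ ∀ a : ↥A, ψ ↑a = φ a) ∧
  HasApproxUnitIn A


section Helpers

open scoped ComplexOrder

lemma aux_norm_sub_le {C : Type*} [NonUnitalCStarAlgebra C] [PartialOrder C] [StarOrderedRing C]
    {a b : C} (ha : 0 ≤ a) (ha1 : ‖a‖ ≤ 1) (hb : 0 ≤ b) (hb1 : ‖b‖ ≤ 1) : ‖a - b‖ ≤ 1 := by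
  obtain ⟨ha0, ha1⟩ := CStarAlgebra.inr_mem_Icc_iff_norm_le.mpr ⟨ha, ha1⟩
  obtain ⟨hb0, hb1⟩ := CStarAlgebra.inr_mem_Icc_iff_norm_le.mpr ⟨hb, hb1⟩
  rw [← Unitization.norm_inr (𝕜 := ℂ) (a - b), Unitization.inr_sub]
  set x : Unitization ℂ C := (a : Unitization ℂ C) - b with hx
  have hsa : IsSelfAdjoint x := (IsSelfAdjoint.of_nonneg ha0).sub (IsSelfAdjoint.of_nonneg hb0)
  have h1 : x ≤ algebraMap ℝ _ 1 := by
    rw [map_one]; exact (sub_le_self _ hb0).trans ha1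
  have h2 : algebraMap ℝ _ (-1) ≤ x := by
    rw [map_neg, map_one, hx, neg_le_sub_iff_le_add]; exact hb1.trans (le_add_of_nonneg_left ha0)
  rw [le_algebraMap_iff_spectrum_le] at h1
  rw [algebraMap_le_iff_le_spectrum] at h2
  rcases CStarAlgebra.norm_or_neg_norm_mem_spectrum hsa with h | h
  · exact h1 _ h
  · linarith [h2 _ h]

lemma aux_state_of_approx {C : Type*} [NonUnitalCStarAlgebra C] [PartialOrder C]
    [StarOrderedRing C] (ψ : C →L[ℂ] ℂ) (hψ : ‖ψ‖ = 1) {ι : Type*} (l : Filter ι) [l.NeBot]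
    (w : ι → C) (h0 : ∀ᶠ i in l, 0 ≤ w i) (h1 : ∀ᶠ i in l, ‖w i‖ ≤ 1)
    (hl : ∀ b, Tendsto (fun i => w i * b) l (𝓝 b)) (hr : ∀ b, Tendsto (fun i => b * w i) l (𝓝 b))
    (hlim : Tendsto (fun i => ψ (w i)) l (𝓝 1)) : IsState ψ := by
  have hle : ∀ x, ‖ψ x‖ ≤ ‖x‖ := fun x => by simpa [hψ] using ψ.le_opNorm x
  have hreal : ∀ b : C, IsSelfAdjoint b → (ψ b).im = 0 := by
    intro b hb
    have key : ∀ n : ℝ, ‖ψ b - (Complex.I * n)‖ ^ 2 ≤ ‖b‖ ^ 2 + n ^ 2 := by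
      intro n
      have t1 : Tendsto (fun i => ‖ψ (b - (Complex.I * n) • w i)‖ ^ 2) l
          (𝓝 (‖ψ b - (Complex.I * n)‖ ^ 2)) := by
        have := ((tendsto_const_nhds (x := ψ b)).sub
          (hlim.const_mul (Complex.I * n))).norm.pow 2
        simpa using this
      have t2 : Tendsto (fun i => ‖b‖ ^ 2 + n ^ 2 + |n| * ‖w i * b - b * w i‖) l
          (𝓝 (‖b‖ ^ 2 + n ^ 2)) := by
        have := (((hl b).sub (hr b)).norm.const_mul |n|).const_add (‖b‖ ^ 2 + n ^ 2)
        simpa using this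
      refine le_of_tendsto_of_tendsto t1 t2 ?_
      filter_upwards [h0, h1] with i hi0 hi1
      have hw : star (w i) = w i := (IsSelfAdjoint.of_nonneg hi0).star_eq
      calc ‖ψ (b - (Complex.I * n) • w i)‖ ^ 2 ≤ ‖b - (Complex.I * n) • w i‖ ^ 2 := by
            gcongr; exact hle _
        _ = ‖star (b - (Complex.I * n) • w i) * (b - (Complex.I * n) • w i)‖ := by
            rw [CStarRing.norm_star_mul_self, sq]
        _ = ‖b * b + ((n : ℂ) ^ 2) • (w i * w i) + (Complex.I * n) • (w i * b - b * w i)‖ := by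
            congr 1
            simp only [star_sub, star_smul, hb.star_eq, hw, sub_mul, mul_sub, smul_mul_assoc,
              mul_smul_comm, smul_sub, smul_smul]
            have e1 : star (Complex.I * (n : ℂ)) = -(Complex.I * n) := by simp
            have e2 : -(Complex.I * (n : ℂ)) * (Complex.I * n) = (n : ℂ) ^ 2 := by
              linear_combination (-(n : ℂ) ^ 2) * Complex.I_sq
            have e3 : (Complex.I * (n : ℂ)) * -(Complex.I * n) = (n : ℂ) ^ 2 := by
              linear_combination (-(n : ℂ) ^ 2) * Complex.I_sq
            simp only [e1, e3, neg_smul]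
            abel
        _ ≤ ‖b‖ * ‖b‖ + n ^ 2 * (1 * 1) + |n| * ‖w i * b - b * w i‖ := by
            refine (norm_add₃_le).trans ?_
            have : ‖Complex.I * (n : ℂ)‖ = |n| := by simp
            rw [norm_smul, norm_smul, this]
            have : ‖(n : ℂ) ^ 2‖ = n ^ 2 := by simp
            rw [this]
            gcongr
            · exact norm_mul_le _ _
            · exact (norm_mul_le _ _).trans (by gcongr)
        _ = _ := by ring
    by_contra hβ
    have := key (-(‖b‖ ^ 2 + 1) / (2 * (ψ b).im))
    set n := -(‖b‖ ^ 2 + 1) / (2 * (ψ b).im) with hn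
    have hn' : 2 * (ψ b).im * n = -(‖b‖ ^ 2 + 1) := by rw [hn]; field_simp
    rw [Complex.sq_norm, Complex.normSq_apply] at this
    simp at this
    nlinarith [mul_self_nonneg (ψ b).re, mul_self_nonneg (ψ b).im]
  have hpos1 : ∀ b : C, 0 ≤ b → ‖b‖ ≤ 1 → 0 ≤ (ψ b).re := by
    intro b hb hb1
    have t : Tendsto (fun i => ‖ψ (w i - b)‖) l (𝓝 ‖1 - ψ b‖) := by
      simpa using (hlim.sub_const (ψ b)).norm
    have h : ‖1 - ψ b‖ ≤ 1 := by
      refine le_of_tendsto t ?_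
      filter_upwards [h0, h1] with i hi0 hi1
      exact (hle _).trans (aux_norm_sub_le hi0 hi1 hb hb1)
    have := (Complex.abs_re_le_norm _).trans h
    simp at this
    linarith [(abs_le.mp this).2]
  refine ⟨hψ, fun c => ⟨(ψ (star c * c)).re, ?_, ?_⟩⟩
  · by_cases hc : c = 0
    · simp [hc]
    have hp : 0 < ‖c‖ := norm_pos_iff.mpr hc
    have := hpos1 (star (((‖c‖⁻¹ : ℝ) : ℂ) • c) * (((‖c‖⁻¹ : ℝ) : ℂ) • c)) (star_mul_self_nonneg _)
      (by rw [CStarRing.norm_star_mul_self, norm_smul]; simp [hp.ne'])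
    rw [star_smul, smul_mul_smul_comm, map_smul] at this
    rw [Complex.star_def, Complex.conj_ofReal, ← Complex.ofReal_mul, smul_eq_mul,
      Complex.re_ofReal_mul] at this
    exact nonneg_of_mul_nonneg_right this (by positivity)
  · have := hreal _ (IsSelfAdjoint.star_mul_self c)
    exact Complex.ext rfl (by simpa using this)

lemma aux_state_lim {D : Type*} [NonUnitalCStarAlgebra D] [PartialOrder D]
    [StarOrderedRing D] (φ : D →L[ℂ] ℂ) (hφ : IsState φ) :
    Tendsto (fun e => φ (star e * e)) (CStarAlgebra.approximateUnit D) (𝓝 1) := by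
  have hu := CStarAlgebra.increasingApproximateUnit D
  have hle : ∀ x, ‖φ x‖ ≤ ‖x‖ := fun x => by simpa [hφ.1] using φ.le_opNorm x
  let f : D →ₚ[ℂ] ℂ := PositiveLinearMap.mk₀ φ.toLinearMap (by
    intro x hx
    obtain ⟨y, rfl⟩ := CStarAlgebra.nonneg_iff_eq_star_mul_self.mp hx
    obtain ⟨r, hr, h⟩ := hφ.2 y
    simpa [h] using hr)
  have hf : ∀ x, f x = φ x := fun x => rfl
  have CS : ∀ x y : D, ‖φ (star x * y)‖ ^ 2 ≤ (φ (star x * x)).re * (φ (star y * y)).re := by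
    intro x y
    have h := norm_inner_le_norm (𝕜 := ℂ) (f.toPreGNS x) (f.toPreGNS y)
    have hx := f.preGNS_norm_sq (f.toPreGNS x)
    have hy := f.preGNS_norm_sq (f.toPreGNS y)
    rw [f.preGNS_inner_def] at h
    simp only [f.ofPreGNS_toPreGNS, hf] at h hx hy
    rw [← hx, ← hy]
    norm_cast
    rw [← mul_pow]
    gcongr
  have him : ∀ x, φ (star x * x) = ((φ (star x * x)).re : ℂ) := by
    intro x
    obtain ⟨r, hr, h⟩ := hφ.2 x
    simp [h]
  suffices h : Tendsto (fun e => (φ (star e * e)).re) (CStarAlgebra.approximateUnit D) (𝓝 1) by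
    have := (Complex.continuous_ofReal.tendsto 1).comp h
    simp only [Function.comp_def, ← him] at this
    simpa using this
  have hub : ∀ᶠ e in CStarAlgebra.approximateUnit D, (φ (star e * e)).re ≤ 1 := by
    filter_upwards [hu.eventually_norm] with e he
    refine (Complex.re_le_norm _).trans ((hle _).trans ?_)
    rw [CStarRing.norm_star_mul_self]
    exact mul_le_one₀ he (norm_nonneg _) he
  refine tendsto_order.mpr ⟨fun r hr => ?_, fun r hr => hub.mono fun e he => he.trans_lt hr⟩
  by_cases hr0 : r < 0
  · filter_upwards with e
    obtain ⟨s, hs, h⟩ := hφ.2 e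
    simp only [h, Complex.ofReal_re]; linarith
  push Not at hr0
  have hs1 : √r < ‖φ‖ := by rw [hφ.1, Real.sqrt_lt' one_pos]; simpa
  obtain ⟨a, ha1, ha⟩ := φ.exists_lt_apply_of_lt_opNorm hs1
  have t : Tendsto (fun e => ‖φ (e * a)‖) (CStarAlgebra.approximateUnit D) (𝓝 ‖φ a‖) :=
    ((φ.continuous.tendsto a).comp (hu.tendsto_mul_right a)).norm
  filter_upwards [t.eventually (lt_mem_nhds ha), hu.eventually_star_eq] with e he hse
  have h := CS e a
  have hsa : (φ (star a * a)).re ≤ 1 := by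
    refine (Complex.re_le_norm _).trans ((hle _).trans ?_)
    rw [CStarRing.norm_star_mul_self]
    exact mul_le_one₀ ha1.le (norm_nonneg _) ha1.le
  have hnn : 0 ≤ (φ (star e * e)).re := by
    obtain ⟨s, hs, h⟩ := hφ.2 e
    simpa [h] using hs
  rw [Real.sqrt_lt' (lt_of_le_of_lt (Real.sqrt_nonneg r) he)] at he
  nth_rewrite 1 [hse] at h
  exact he.trans_le (h.trans (mul_le_of_le_one_right hnn hsa))

lemma aux_ext_state {C : Type*} [NonUnitalCStarAlgebra C]
    (S : NonUnitalStarSubalgebra ℂ C) (hS : IsClosed (S : Set C)) (hu : HasApproxUnitIn S)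
    (φ : S →L[ℂ] ℂ) (hφ : IsState φ) (ψ : C →L[ℂ] ℂ) (hψ : ‖ψ‖ = 1)
    (hext : ∀ a : S, ψ a = φ a) : IsState ψ := by
  let _ : PartialOrder C := CStarAlgebra.spectralOrder C
  have _ : StarOrderedRing C := CStarAlgebra.spectralOrderedRing C
  let _ : PartialOrder S := CStarAlgebra.spectralOrder S
  have _ : StarOrderedRing S := CStarAlgebra.spectralOrderedRing S
  have hau := CStarAlgebra.increasingApproximateUnit S
  have hlim := aux_state_lim φ hφ
  have hl : ∀ b : C, Tendsto (fun e : S => (e : C) * b) (CStarAlgebra.approximateUnit S) (𝓝 b) := by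
    intro b
    obtain ⟨ι, l, u, hne, huS, hu⟩ := hu
    rw [Metric.tendsto_nhds]
    intro ε hε
    obtain ⟨j, hj⟩ := ((Metric.tendsto_nhds.mp (hu b).1) (ε / 3) (by positivity)).exists
    rw [dist_eq_norm] at hj
    have t : Tendsto (fun e : S => (e : C) * u j * b) (CStarAlgebra.approximateUnit S)
        (𝓝 (u j * b)) :=
      ((continuous_subtype_val.tendsto _).comp
        (hau.tendsto_mul_right (⟨u j, huS j⟩ : S))).mul_const b
    filter_upwards [Metric.tendsto_nhds.mp t (ε / 3) (by positivity), hau.eventually_norm]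
      with e he he1
    rw [dist_eq_norm] at he ⊢
    have e1 : (e : C) * b - b = (e * u j * b - u j * b) + (u j * b - b) - e * (u j * b - b) := by
      rw [mul_sub, mul_assoc]; abel
    have e2 : ‖(e : C) * (u j * b - b)‖ ≤ 1 * ‖u j * b - b‖ :=
      (norm_mul_le _ _).trans (by gcongr; exact he1)
    rw [e1]
    have := norm_sub_le ((e * u j * b - u j * b) + (u j * b - b)) (e * (u j * b - b))
    have := norm_add_le (e * u j * b - u j * b) (u j * b - b)
    linarith
  have hr : ∀ b : C, Tendsto (fun e : S => b * (e : C)) (CStarAlgebra.approximateUnit S) (𝓝 b) := by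
    intro b
    have := (continuous_star.tendsto _).comp (hl (star b))
    rw [star_star] at this
    refine this.congr' ?_
    filter_upwards [hau.eventually_star_eq] with e he
    have he' : star (e : C) = e := congrArg Subtype.val he
    simp [he']
  refine aux_state_of_approx ψ hψ (CStarAlgebra.approximateUnit S)
    (fun e => star (e : C) * e) (.of_forall fun e => star_mul_self_nonneg _) ?_ ?_ ?_ ?_
  · filter_upwards [hau.eventually_norm] with e he
    rw [CStarRing.norm_star_mul_self]
    exact mul_le_one₀ he (norm_nonneg _) he
  · intro b
    have h2 : Tendsto (fun e : S => (e : C) * (e * b - b) + e * b)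
        (CStarAlgebra.approximateUnit S) (𝓝 (0 + b)) := by
      refine Tendsto.add ?_ (hl b)
      refine squeeze_zero_norm' (a := fun e : S => ‖(e : C) * b - b‖) ?_ ?_
      · filter_upwards [hau.eventually_norm] with e he
        exact (norm_mul_le _ _).trans (mul_le_of_le_one_left (norm_nonneg _) he)
      · simpa using ((hl b).sub_const b).norm
    rw [zero_add] at h2
    refine h2.congr' ?_
    filter_upwards [hau.eventually_star_eq] with e he
    have he' : star (e : C) = e := congrArg Subtype.val he
    rw [he', mul_sub, mul_assoc]; abel
  · intro b
    have h2 : Tendsto (fun e : S => (b * e - b) * (e : C) + b * e)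
        (CStarAlgebra.approximateUnit S) (𝓝 (0 + b)) := by
      refine Tendsto.add ?_ (hr b)
      refine squeeze_zero_norm' (a := fun e : S => ‖b * (e : C) - b‖) ?_ ?_
      · filter_upwards [hau.eventually_norm] with e he
        exact (norm_mul_le _ _).trans (mul_le_of_le_one_right (norm_nonneg _) he)
      · simpa using ((hr b).sub_const b).norm
    rw [zero_add] at h2
    refine h2.congr' ?_
    filter_upwards [hau.eventually_star_eq] with e he
    have he' : star (e : C) = e := congrArg Subtype.val he
    rw [he', sub_mul, mul_assoc]; abel
  · refine hlim.congr fun e => ?_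
    rw [← hext]; rfl

lemma aux_state_comp {E F : Type*} [NonUnitalNormedRing E] [StarRing E] [NormedSpace ℂ E]
    [NonUnitalNormedRing F] [StarRing F] [NormedSpace ℂ F] (T : E ≃ₗᵢ[ℂ] F)
    (hT : ∀ x, T (star x * x) = star (T x) * T x) (φ : F →L[ℂ] ℂ) (hφ : IsState φ) :
    IsState (φ ∘L (T.toContinuousLinearEquiv : E →L[ℂ] F)) := by
  refine ⟨(φ.opNorm_comp_linearIsometryEquiv T).trans hφ.1, fun b => ?_⟩
  obtain ⟨r, hr, h⟩ := hφ.2 (T b)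
  exact ⟨r, hr, by simpa [hT] using h⟩

lemma aux_pure_comp {E F : Type*} [NonUnitalNormedRing E] [StarRing E] [NormedSpace ℂ E]
    [NonUnitalNormedRing F] [StarRing F] [NormedSpace ℂ F] (T : E ≃ₗᵢ[ℂ] F)
    (hT : ∀ x, T (star x * x) = star (T x) * T x) (φ : F →L[ℂ] ℂ) (hφ : IsPureState φ) :
    IsPureState (φ ∘L (T.toContinuousLinearEquiv : E →L[ℂ] F)) := by
  have hT' : ∀ y, T.symm (star y * y) = star (T.symm y) * T.symm y := by
    intro y
    apply T.injective
    rw [hT]; simp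
  refine ⟨aux_state_comp T hT φ hφ.1, fun ψ₁ ψ₂ t h1 h2 ht0 ht1 h => ?_⟩
  have := hφ.2 _ _ t (aux_state_comp T.symm hT' ψ₁ h1) (aux_state_comp T.symm hT' ψ₂ h2) ht0 ht1
    (by
      ext y
      have := congrArg (fun f : E →L[ℂ] ℂ => f (T.symm y)) h
      simpa using this)
  ext x
  have := congrArg (fun f : F →L[ℂ] ℂ => f (T x)) this
  simpa using this

end Helpers

/-- If `π : B → B₁` is a quotient map of C*-algebras whose kernel intersects `A`
trivially, and `A` has the extension property relative to `B`, then `π(A)` has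
the extension property relative to `B₁`. -/
theorem extensionProperty_quotient
    {B₁ : Type*} [NonUnitalNormedRing B₁] [StarRing B₁] [CStarRing B₁]
    [NormedSpace ℂ B₁] [IsScalarTower ℂ B₁ B₁] [SMulCommClass ℂ B₁ B₁]
    [StarModule ℂ B₁] [CompleteSpace B₁]
    (π : B →⋆ₙₐ[ℂ] B₁) (hsurj : Function.Surjective π)
    (A : NonUnitalStarSubalgebra ℂ B) (hA : IsClosed (A : Set B))
    (hker : ∀ a ∈ A, π a = 0 → a = 0)
    (hiso : ∀ a ∈ A, ‖π a‖ = ‖a‖)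
    (hEP : ExtensionProperty A) :
    ExtensionProperty (A.map π) := by
  let _ : NonUnitalCStarAlgebra B := { }
  let _ : NonUnitalCStarAlgebra B₁ := { }
  obtain ⟨hext, hunit⟩ := hEP
  have hcontr : ∀ b, ‖π b‖ ≤ ‖b‖ := NonUnitalStarAlgHom.norm_apply_le π
  have hπs : ∀ b : B, π (star b * b) = star (π b) * π b := fun b =>
    (map_mul π _ _).trans (congrArg (· * π b) (π.map_star' b))
  have hunit₁ : HasApproxUnitIn (A.map π) := by
    obtain ⟨ι, l, u, hne, huA, hu⟩ := hunit
    have hc : Continuous π :=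
      AddMonoidHomClass.continuous_of_bound π 1 (fun x => by simpa using hcontr x)
    refine ⟨ι, l, fun i => π (u i), hne, fun i => ⟨u i, huA i, rfl⟩, fun b => ?_⟩
    obtain ⟨b, rfl⟩ := hsurj b
    refine ⟨?_, ?_⟩
    · simpa [Function.comp_def] using (hc.tendsto _).comp (hu b).1
    · simpa [Function.comp_def] using (hc.tendsto _).comp (hu b).2
  refine ⟨fun φ hφ => ?_, hunit₁⟩
  let T₀ : A →ₗ[ℂ] (A.map π) :=
    { toFun := fun a => ⟨π a, ⟨a, a.2, rfl⟩⟩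
      map_add' := fun a b => Subtype.ext (map_add π (a : B) b)
      map_smul' := fun c a => Subtype.ext (map_smul π c (a : B)) }
  have hT₀ : Function.Bijective T₀ := by
    refine ⟨(injective_iff_map_eq_zero T₀).mpr fun a ha => ?_, ?_⟩
    · exact Subtype.ext (hker a a.2 (congrArg Subtype.val ha))
    · rintro ⟨_, a, ha, rfl⟩
      exact ⟨⟨a, ha⟩, rfl⟩
  let T : A ≃ₗᵢ[ℂ] (A.map π) :=
    { LinearEquiv.ofBijective T₀ hT₀ with
      norm_map' := fun a => hiso a a.2 }
  have hTv : ∀ a : A, ((T a : A.map π) : B₁) = π a := fun a => rfl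
  have hT : ∀ x, T (star x * x) = star (T x) * T x := fun x => Subtype.ext (by
    have h : π (star (x : B) * x) = star (π x) * π x := hπs x
    exact h)
  have hpure := aux_pure_comp T hT φ hφ
  obtain ⟨ψ₀, -, huniq⟩ := hext _ hpure
  have hclosed : IsClosed ((A.map π : NonUnitalStarSubalgebra ℂ B₁) : Set B₁) := by
    have : CompleteSpace A := hA.completeSpace_coe
    have : CompleteSpace (A.map π) := T.toIsometryEquiv.completeSpace_iff.mp this
    exact (completeSpace_coe_iff_isComplete.mp this).isClosed
  let π' : B →L[ℂ] B₁ := LinearMap.mkContinuous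
    { toFun := π, map_add' := map_add π, map_smul' := fun c a => map_smul π c a } 1
    (fun x => by simpa using hcontr x)
  have hπ' : ∀ b, π' b = π b := fun b => rfl
  have hπn : ‖π'‖ ≤ 1 := LinearMap.mkContinuous_norm_le _ zero_le_one _
  obtain ⟨ψ, hψe, hψn⟩ := exists_extension_norm_eq
    (A.map π).toNonUnitalSubalgebra.toSubmodule φ
  have hψS : IsState ψ :=
    aux_ext_state (A.map π) hclosed hunit₁ φ hφ.1 ψ (hψn.trans hφ.1.1) hψe
  have pull : ∀ χ : B₁ →L[ℂ] ℂ, (IsState χ ∧ ∀ a : A.map π, χ a = φ a) → χ ∘L π' = ψ₀ := by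
    rintro χ ⟨⟨hχn, hχp⟩, hχe⟩
    have hval : ∀ a : A, (χ ∘L π') a = (φ ∘L (T.toContinuousLinearEquiv : A →L[ℂ] A.map π)) a :=
      fun a => hχe (T a)
    refine huniq _ ⟨⟨le_antisymm ?_ ?_, fun b => ?_⟩, hval⟩
    · refine (χ.opNorm_comp_le π').trans ?_
      rw [hχn, one_mul]; exact hπn
    · rw [← hpure.1.1]
      refine ContinuousLinearMap.opNorm_le_bound _ (norm_nonneg _) fun a => ?_
      rw [← hval]
      exact (χ ∘L π').le_opNorm (a : B)
    · obtain ⟨r, hr, h⟩ := hχp (π b)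
      exact ⟨r, hr, (congrArg χ (hπs b)).trans h⟩
  refine ⟨ψ, ⟨hψS, hψe⟩, fun χ hχ => ?_⟩
  have h := (pull χ hχ).trans (pull ψ ⟨hψS, hψe⟩).symm
  ext b
  obtain ⟨b, rfl⟩ := hsurj b
  exact congrArg (fun f : B →L[ℂ] ℂ => f b) h
end
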